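/- arXiv:1011.3829 — 5 statements merged into one kernel-verified Lean document; each statement's English description precedes it below -/
import Mathlib

section
/- Assume f is continuous and satisfies (f₄). Then for every s ≠ 0 and every t ≥ 1 one has F(ts) ≥ t^μ F(s) > 0; in particular F(s) ≥ F(1)·s^μ for all s ≥ 1 and F(s) ≥ F(−1)·|s|^μ for all s ≤ −1. -/
/-- A function satisfying the Euler inequality `μ g(t) ≤ t g'(t)` on `[1, ∞)` grows at least
like `t ^ μ`. -/
theorem rpow_mul_le_of_mul_le_mul_deriv {g g' : ℝ → ℝ} {μ : ℝ}
    (hg : ∀ t, 1 ≤ t → HasDerivAt g (g' t) t) (h : ∀ t, 1 ≤ t → μ * g t ≤ t * g' t)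
    {t : ℝ} (ht : 1 ≤ t) : t ^ μ * g 1 ≤ g t := by
  have hd : ∀ x : ℝ, 1 ≤ x → HasDerivAt (fun x => g x * x ^ (-μ))
      (g' x * x ^ (-μ) + g x * (-μ * x ^ (-μ - 1))) x := fun x hx =>
    (hg x hx).mul (Real.hasDerivAt_rpow_const (Or.inl (by linarith)))
  have hmono : MonotoneOn (fun x => g x * x ^ (-μ)) (Set.Ici 1) := by
    refine monotoneOn_of_hasDerivWithinAt_nonneg (convex_Ici 1)
      (fun x hx => (hd x hx).continuousAt.continuousWithinAt)
      (fun x hx => (hd x (interior_subset hx)).hasDerivWithinAt) fun x hx => ?_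
    have hx1 : 1 ≤ x := interior_subset hx
    have hx0 : 0 < x := by linarith
    have hsplit : x ^ (-μ) = x ^ (-μ - 1) * x := by
      rw [← Real.rpow_add_one hx0.ne', sub_add_cancel]
    rw [hsplit]
    have := mul_nonneg (Real.rpow_nonneg hx0.le (-μ - 1)) (sub_nonneg.2 (h x hx1))
    linarith
  have h1 := hmono Set.self_mem_Ici ht ht
  have ht0 : 0 < t := by linarith
  simp only [Real.one_rpow, mul_one, Real.rpow_neg ht0.le, ← div_eq_mul_inv] at h1
  rw [mul_comm]
  exact (le_div_iff₀ (Real.rpow_pos_of_pos ht0 μ)).1 h1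

/-- Assume `f` is continuous and satisfies (f₄): there is `μ > 2` with
`0 < μ F(s) ≤ s f(s)` for all `s ≠ 0`, where `F(s) = ∫₀ˢ f`. Then for every `s ≠ 0`
and every `t ≥ 1` one has `F(ts) ≥ t^μ F(s) > 0`; in particular `F(s) ≥ F(1)·s^μ`
for `s ≥ 1` and `F(s) ≥ F(-1)·|s|^μ` for `s ≤ -1`. -/
theorem F_superhomogeneous
    (f : ℝ → ℝ) (hf : Continuous f)
    (F : ℝ → ℝ) (hF : ∀ s : ℝ, F s = ∫ t in (0 : ℝ)..s, f t)
    (μ : ℝ) (hμ : 2 < μ)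
    (hAR : ∀ s : ℝ, s ≠ 0 → 0 < μ * F s ∧ μ * F s ≤ s * f s) :
    (∀ s : ℝ, s ≠ 0 → ∀ t : ℝ, 1 ≤ t → t ^ μ * F s > 0 ∧ F (t * s) ≥ t ^ μ * F s) ∧
    (∀ s : ℝ, 1 ≤ s → F s ≥ F 1 * s ^ μ) ∧
    (∀ s : ℝ, s ≤ -1 → F s ≥ F (-1) * |s| ^ μ) := by
  have hderiv : ∀ s, HasDerivAt F (f s) s := fun s => by
    rw [funext hF]
    exact hf.integral_hasStrictDerivAt 0 s |>.hasDerivAt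
  have hgrow : ∀ s : ℝ, s ≠ 0 → ∀ t : ℝ, 1 ≤ t → t ^ μ * F s ≤ F (t * s) := by
    intro s hs t ht
    have hd : ∀ x : ℝ, 1 ≤ x → HasDerivAt (fun x => F (x * s)) (f (x * s) * s) x :=
      fun x _ => (hderiv (x * s)).comp x (hasDerivAt_mul_const s)
    have hEuler : ∀ x : ℝ, 1 ≤ x → μ * F (x * s) ≤ x * (f (x * s) * s) := by
      intro x hx
      have := (hAR (x * s) (mul_ne_zero (by linarith) hs)).2
      linarith
    simpa using rpow_mul_le_of_mul_le_mul_deriv hd hEuler ht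
  refine ⟨fun s hs t ht => ⟨?_, hgrow s hs t ht⟩, fun s hs => ?_, fun s hs => ?_⟩
  · exact mul_pos (Real.rpow_pos_of_pos (by linarith) μ)
      (pos_of_mul_pos_right (hAR s hs).1 (by linarith))
  · simpa [mul_comm] using hgrow 1 one_ne_zero s hs
  · have h := hgrow (-1) (by norm_num) (-s) (by linarith)
    rw [abs_of_neg (by linarith)]
    simpa [mul_comm] using h
end

section
/- Let K > 0 and let a > 0 satisfy max{ f(a)/a , f(−a)/(−a) } ≤ K. Then the truncation f̃ satisfies 0 < s f̃(s) ≤ K s² for all s ≠ 0. -/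
open Set

/-- The truncation `f̃` of `f` at level `a`. -/
noncomputable def ftrunc (f : ℝ → ℝ) (a : ℝ) : ℝ → ℝ := fun s =>
  if s < -a then (f (-a) / (-a)) * s
  else if s ≤ a then f s
  else (f a / a) * s

/-- Let `K > 0` and let `a > 0` satisfy
`max (f a / a) (f (-a) / (-a)) ≤ K`. Then the truncation `f̃` satisfies
`0 < s f̃(s) ≤ K s²` for all `s ≠ 0`. -/
theorem ftrunc_sign_and_bound
    (f : ℝ → ℝ) (hf : Continuous f)
    (F : ℝ → ℝ) (hF : ∀ s : ℝ, F s = ∫ t in (0 : ℝ)..s, f t)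
    (μ : ℝ) (hμ : 2 < μ)
    (hAR : ∀ s : ℝ, s ≠ 0 → 0 < μ * F s ∧ μ * F s ≤ s * f s)
    (hmono : StrictMonoOn (fun s => f s / s) (Ioi (0 : ℝ)))
    (hanti : StrictAntiOn (fun s => f s / s) (Iio (0 : ℝ)))
    (K : ℝ) (hK : 0 < K)
    (a : ℝ) (ha : 0 < a) (haK : max (f a / a) (f (-a) / (-a)) ≤ K) :
    ∀ s : ℝ, s ≠ 0 → 0 < s * ftrunc f a s ∧ s * ftrunc f a s ≤ K * s ^ 2 := by
  obtain ⟨hKpos, hKneg⟩ := max_le_iff.mp haK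
  have quot_pos : ∀ s : ℝ, s ≠ 0 → 0 < f s / s := fun s hs => by
    have hsf : 0 < s * f s := (hAR s hs).1.trans_le (hAR s hs).2
    have hdiv : f s / s = s * f s / s ^ 2 := by field_simp
    rw [hdiv]
    positivity
  have quot_le : ∀ s : ℝ, s ≠ 0 → -a ≤ s → s ≤ a → f s / s ≤ K := fun s hs hl hr => by
    rcases lt_or_gt_of_ne hs with h | h
    · exact (hanti.antitoneOn (mem_Iio.mpr (neg_lt_zero.mpr ha)) (mem_Iio.mpr h) hl).trans hKneg
    · exact (hmono.monotoneOn (mem_Ioi.mpr h) (mem_Ioi.mpr ha) hr).trans hKpos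
  intro s hs
  have hs2 : 0 < s ^ 2 := by positivity
  suffices ∃ c, 0 < c ∧ c ≤ K ∧ ftrunc f a s = c * s by
    obtain ⟨c, hc, hcK, h⟩ := this
    have hmul : s * ftrunc f a s = c * s ^ 2 := by rw [h]; ring
    rw [hmul]
    exact ⟨mul_pos hc hs2, mul_le_mul_of_nonneg_right hcK hs2.le⟩
  unfold ftrunc
  split_ifs with h₁ h₂
  · exact ⟨_, quot_pos (-a) (neg_ne_zero.mpr ha.ne'), hKneg, rfl⟩
  · exact ⟨_, quot_pos s hs, quot_le s hs (not_lt.mp h₁) h₂, (div_mul_cancel₀ _ hs).symm⟩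
  · exact ⟨_, quot_pos a ha.ne', hKpos, rfl⟩
end

section
/- Let a > 0. Then the truncation f̃ satisfies 0 < 2 F̃(s) ≤ s f̃(s) for all s ≠ 0, where F̃(s) = ∫₀^s f̃(t) dt. -/
open Set

open intervalIntegral in
/-- The integral of a function that equals `f` between `0` and `b` and is linear between `b`
and `s`. -/
lemma integral_eq_add_of_linear {f g : ℝ → ℝ} (hf : Continuous f) {b c s : ℝ}
    (h₁ : EqOn g f (uIcc 0 b)) (h₂ : EqOn g (fun t => c * t) (uIcc b s)) :
    ∫ t in (0 : ℝ)..s, g t = (∫ t in (0 : ℝ)..b, f t) + c * ((s ^ 2 - b ^ 2) / 2) := by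
  have i₁ : IntervalIntegrable g MeasureTheory.volume 0 b :=
    (hf.continuousOn.congr h₁).intervalIntegrable
  have i₂ : IntervalIntegrable g MeasureTheory.volume b s :=
    ((continuous_const_mul c).continuousOn.congr h₂).intervalIntegrable
  rw [← integral_add_adjacent_intervals i₁ i₂, integral_congr h₁, integral_congr h₂,
    integral_const_mul, integral_id]

/-- The quadratic extension of an energy beyond `b` satisfies the Ambrosetti–Rabinowitz
inequality with exponent two. -/
lemma two_mul_extension_pos_and_le {I y b s : ℝ} (hb : b ≠ 0) (hI : 0 < I)
    (hle : 2 * I ≤ b * y) (hs : b ^ 2 ≤ s ^ 2) :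
    0 < 2 * (I + y / b * ((s ^ 2 - b ^ 2) / 2)) ∧
      2 * (I + y / b * ((s ^ 2 - b ^ 2) / 2)) ≤ s * (y / b * s) := by
  have hy : b * y = y / b * b ^ 2 := by field_simp
  have hb2 : 0 < b ^ 2 := by positivity
  have hc : 0 < y / b := by
    refine pos_of_mul_pos_left ?_ hb2.le
    linarith
  have := mul_nonneg hc.le (sub_nonneg.2 hs)
  constructor <;> nlinarith

/-- Let `a > 0`. Then the truncation `f̃` satisfies
`0 < 2 F̃(s) ≤ s f̃(s)` for all `s ≠ 0`, where `F̃(s) = ∫₀ˢ f̃`. -/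
theorem ftrunc_AR_two
    (f : ℝ → ℝ) (hf : Continuous f)
    (F : ℝ → ℝ) (hF : ∀ s : ℝ, F s = ∫ t in (0 : ℝ)..s, f t)
    (μ : ℝ) (hμ : 2 < μ)
    (hAR : ∀ s : ℝ, s ≠ 0 → 0 < μ * F s ∧ μ * F s ≤ s * f s)
    (a : ℝ) (ha : 0 < a)
    (Ftr : ℝ → ℝ) (hFtr : ∀ s : ℝ, Ftr s = ∫ t in (0 : ℝ)..s, ftrunc f a t) :
    ∀ s : ℝ, s ≠ 0 → 0 < 2 * Ftr s ∧ 2 * Ftr s ≤ s * ftrunc f a s := by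
  have mid : ∀ t, -a ≤ t → t ≤ a → ftrunc f a t = f t := fun t h₁ h₂ => by
    simp [ftrunc, not_lt.2 h₁, h₂]
  have right : ∀ t, a ≤ t → ftrunc f a t = f a / a * t := fun t h => by
    rcases h.eq_or_lt with rfl | h
    · rw [mid a (by linarith) le_rfl]
      field_simp
    · simp [ftrunc, not_lt.2 (by linarith : -a ≤ t), not_le.2 h]
  have left : ∀ t, t ≤ -a → ftrunc f a t = f (-a) / (-a) * t := fun t h => by
    rcases h.eq_or_lt with rfl | h
    · rw [mid (-a) le_rfl (by linarith)]
      field_simp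
    · simp [ftrunc, h]
  have energy : ∀ s, s ≠ 0 → 0 < F s ∧ 2 * F s ≤ s * f s := fun s hs => by
    obtain ⟨h₁, h₂⟩ := hAR s hs
    have hp : 0 < F s := pos_of_mul_pos_right h₁ (by linarith)
    exact ⟨hp, by nlinarith⟩
  intro s hs
  rcases lt_or_ge s (-a) with h | h
  · obtain ⟨h₁, h₂⟩ := energy (-a) (by linarith)
    rw [left s h.le, hFtr, integral_eq_add_of_linear (b := -a) (c := f (-a) / (-a)) hf, ← hF]
    · exact two_mul_extension_pos_and_le (by linarith) h₁ h₂ (by nlinarith)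
    · intro t ht
      rw [uIcc_of_ge (by linarith)] at ht
      exact mid t ht.1 (by linarith [ht.2])
    · intro t ht
      rw [uIcc_of_ge h.le] at ht
      exact left t ht.2
  rcases le_or_gt s a with h' | h'
  · obtain ⟨h₁, h₂⟩ := energy s hs
    have key : EqOn (ftrunc f a) f (uIcc 0 s) := fun t ht =>
      have := uIcc_subset_Icc (show (0 : ℝ) ∈ Icc (-a) a by constructor <;> linarith) ⟨h, h'⟩ ht
      mid t this.1 this.2
    rw [hFtr, intervalIntegral.integral_congr key, ← hF, mid s h h']
    exact ⟨by linarith, h₂⟩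
  · obtain ⟨h₁, h₂⟩ := energy a ha.ne'
    rw [right s h'.le, hFtr, integral_eq_add_of_linear (b := a) (c := f a / a) hf, ← hF]
    · exact two_mul_extension_pos_and_le ha.ne' h₁ h₂ (by nlinarith)
    · intro t ht
      rw [uIcc_of_le ha.le] at ht
      exact mid t (by linarith [ht.1]) ht.2
    · intro t ht
      rw [uIcc_of_le h'.le] at ht
      exact right t ht.1
end

section
/- Let a > 0. Then F̃(s) ≤ F(s) for all s ∈ ℝ, where F(s) = ∫₀^s f(t) dt and F̃(s) = ∫₀^s f̃(t) dt. -/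
open Set

lemma continuous_ftrunc {f : ℝ → ℝ} (hf : Continuous f) {a : ℝ} (ha : 0 < a) :
    Continuous (ftrunc f a) := by
  have h : ftrunc f a = fun s => if -a ≤ s then (if s ≤ a then f s else (f a / a) * s)
      else (f (-a) / (-a)) * s := by
    funext s
    by_cases hs : s < -a
    · simp [ftrunc, hs, not_le.mpr hs]
    · simp [ftrunc, hs, not_lt.mp hs]
  rw [h]
  refine Continuous.if_le (Continuous.if_le hf (by fun_prop) continuous_id continuous_const ?_)
    (by fun_prop) continuous_const continuous_id ?_
  · rintro s rfl
    field_simp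
  · rintro s rfl
    have : -a ≤ a := by linarith
    simp only [this, if_true]
    field_simp

lemma ftrunc_le_of_nonneg {f : ℝ → ℝ} (hmono : MonotoneOn (fun s => f s / s) (Ioi (0 : ℝ)))
    {a t : ℝ} (ha : 0 < a) (ht : 0 ≤ t) : ftrunc f a t ≤ f t := by
  rcases le_or_gt t a with h | h
  · simp [ftrunc, h, show ¬ t < -a by linarith]
  · have hpos : 0 < t := ha.trans h
    have := hmono (mem_Ioi.mpr ha) (mem_Ioi.mpr hpos) h.le
    simpa [ftrunc, not_le.mpr h, show ¬ t < -a by linarith] using (le_div_iff₀ hpos).mp this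

lemma le_ftrunc_of_nonpos {f : ℝ → ℝ} (hanti : AntitoneOn (fun s => f s / s) (Iio (0 : ℝ)))
    {a t : ℝ} (ha : 0 < a) (ht : t ≤ 0) : f t ≤ ftrunc f a t := by
  rcases lt_or_ge t (-a) with h | h
  · have hneg : t < 0 := by linarith
    have := hanti (mem_Iio.mpr hneg) (mem_Iio.mpr (neg_lt_zero.mpr ha)) h.le
    simp only [ftrunc, if_pos h]
    exact (le_div_iff_of_neg hneg).mp this
  · simp [ftrunc, not_lt.mpr h, show t ≤ a by linarith]

/-- Let `a > 0`. Then `F̃(s) ≤ F(s)` for all `s ∈ ℝ`, where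
`F(s) = ∫₀ˢ f` and `F̃(s) = ∫₀ˢ f̃`. -/
theorem ftrunc_primitive_le
    (f : ℝ → ℝ) (hf : Continuous f)
    (hmono : StrictMonoOn (fun s => f s / s) (Ioi (0 : ℝ)))
    (hanti : StrictAntiOn (fun s => f s / s) (Iio (0 : ℝ)))
    (a : ℝ) (ha : 0 < a)
    (F : ℝ → ℝ) (hF : ∀ s : ℝ, F s = ∫ t in (0 : ℝ)..s, f t)
    (Ftr : ℝ → ℝ) (hFtr : ∀ s : ℝ, Ftr s = ∫ t in (0 : ℝ)..s, ftrunc f a t) :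
    ∀ s : ℝ, Ftr s ≤ F s := by
  intro s
  rw [hF, hFtr]
  have hint : ∀ u v : ℝ, IntervalIntegrable f MeasureTheory.volume u v :=
    hf.intervalIntegrable
  have hint' : ∀ u v : ℝ, IntervalIntegrable (ftrunc f a) MeasureTheory.volume u v :=
    (continuous_ftrunc hf ha).intervalIntegrable
  rcases le_total 0 s with hs | hs
  · exact intervalIntegral.integral_mono_on hs (hint' _ _) (hint _ _)
      fun t ht => ftrunc_le_of_nonneg hmono.monotoneOn ha ht.1
  · rw [intervalIntegral.integral_symm s 0, intervalIntegral.integral_symm s 0]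
    exact neg_le_neg (intervalIntegral.integral_mono_on hs (hint _ _) (hint' _ _)
      fun t ht => le_ftrunc_of_nonpos hanti.antitoneOn ha ht.2)
end

section
/- Let f : ℝ → ℝ be continuous with f(0) = 0 and such that s ↦ f(s)/s is strictly increasing on (0,∞). Fix s > 0 and define h : [0,∞) → ℝ by h(t) = (t²/2)·s f(s) − F(ts). Then h attains its maximum on [0,∞) uniquely at t = 1; that is, h(t) < h(1) for every t ≥ 0 with t ≠ 1. -/
open Set

/-- Let `f : ℝ → ℝ` be continuous with `f 0 = 0` and such that
`s ↦ f(s)/s` is strictly increasing on `(0,∞)`. Fix `s > 0` and define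
`h t = (t²/2)·s f(s) − F(ts)` on `[0,∞)`, where `F(s) = ∫₀ˢ f`. Then `h`
attains its maximum on `[0,∞)` uniquely at `t = 1`: `h t < h 1` for every
`t ≥ 0` with `t ≠ 1`. -/
theorem nehari_fibering_unique_max
    (f : ℝ → ℝ) (hf : Continuous f) (hf0 : f 0 = 0)
    (hmono : StrictMonoOn (fun s => f s / s) (Ioi (0 : ℝ)))
    (F : ℝ → ℝ) (hF : ∀ s : ℝ, F s = ∫ t in (0 : ℝ)..s, f t)
    (s : ℝ) (hs : 0 < s)
    (h : ℝ → ℝ) (hh : ∀ t : ℝ, h t = t ^ 2 / 2 * (s * f s) - F (t * s)) :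
    ∀ t : ℝ, 0 ≤ t → t ≠ 1 → h t < h 1 := by
  have hderiv (x : ℝ) : HasDerivAt h (s * (x * f s - f (x * s))) x := by
    have hint : HasDerivAt F (f (x * s)) (x * s) := by
      rw [funext hF]
      exact intervalIntegral.integral_hasDerivAt_right (hf.intervalIntegrable _ _)
        (hf.stronglyMeasurableAtFilter _ _) hf.continuousAt
    have hcomp := hint.comp x ((hasDerivAt_id x).mul_const s)
    have hsq := (((hasDerivAt_id x).pow 2).div_const 2).mul_const (s * f s)
    rw [funext hh]
    refine (hsq.sub hcomp).congr_deriv ?_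
    simp
    ring
  have hcont : Continuous h :=
    continuous_iff_continuousAt.2 fun x => (hderiv x).continuousAt
  have hinc : StrictMonoOn h (Icc 0 1) := by
    refine strictMonoOn_of_deriv_pos (convex_Icc 0 1) hcont.continuousOn fun x hx => ?_
    rw [interior_Icc] at hx
    have hxs : 0 < x * s := mul_pos hx.1 hs
    have hlt : f (x * s) / (x * s) < f s / s := hmono hxs hs (by nlinarith [hx.2])
    rw [div_lt_div_iff₀ hxs hs] at hlt
    rw [(hderiv x).deriv]
    linarith
  have hdec : StrictAntiOn h (Ici 1) := by
    refine strictAntiOn_of_deriv_neg (convex_Ici 1) hcont.continuousOn fun x hx => ?_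
    rw [interior_Ici, mem_Ioi] at hx
    have hxs : 0 < x * s := mul_pos (by linarith) hs
    have hlt : f s / s < f (x * s) / (x * s) := hmono hs hxs (by nlinarith)
    rw [div_lt_div_iff₀ hs hxs] at hlt
    rw [(hderiv x).deriv]
    linarith
  intro t ht hne
  rcases lt_or_gt_of_ne hne with hlt | hgt
  · exact hinc ⟨ht, hlt.le⟩ (right_mem_Icc.2 zero_le_one) hlt
  · exact hdec self_mem_Ici hgt.le hgt
end
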